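/- arXiv:2209.14093 — 7 statements merged into one kernel-verified Lean document; each statement's English description precedes it below -/
import Mathlib

section
/- Let T be a maximum-weight spanning tree of the weighted complete graph on C. Then: (i) T contains exactly one edge e having one endpoint in M and the other in C\M; (ii) e is the unique minimum-weight edge of T; (iii) deleting e from T yields exactly two connected components whose vertex sets are exactly M and C\M; and (iv) the average weight of the edges of the component on M is strictly greater than the average weight of the edges of the component on C\M. Hence the MST-AD procedure (build a maximum spanning tree, delete its lowest-weight edge, output the sub-tree of higher average edge weight) returns exactly the set of attackers M. -/
open Finset SimpleGraph

namespace SimpleGraph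

variable {V : Type*} {G T : SimpleGraph V} {a b x y : V}

/-- Exchange property: in a tree, an edge may be replaced by any edge joining two vertices
that its deletion disconnects. -/
lemma IsTree.deleteEdges_sup_edge [Finite V] (hT : T.IsTree) (hab : T.Adj a b)
    (hxy : ¬ (T.deleteEdges {s(a, b)}).Reachable x y) :
    (T.deleteEdges {s(a, b)} ⊔ edge x y).IsTree := by
  have hne : x ≠ y := fun h => hxy (h ▸ Reachable.refl x)
  have hacyc := (hT.isAcyclic.anti (deleteEdges_le {s(a, b)})).sup_edge_of_not_reachable hxy
  have := hT.connected.nonempty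
  obtain ⟨F, hle, -, hF⟩ :=
    (connected_top (V := V)).exists_isTree_le_of_le_of_isAcyclic le_top hacyc
  suffices h : T.deleteEdges {s(a, b)} ⊔ edge x y = F from h ▸ hF
  rw [← edgeSet_inj]
  refine Set.eq_of_subset_of_ncard_le (edgeSet_mono hle) ?_
  have hcT := (isTree_iff_connected_and_card.mp hT).2
  have hcF := (isTree_iff_connected_and_card.mp hF).2
  rw [Nat.card_coe_set_eq] at hcT hcF
  have hnot : s(x, y) ∉ T.edgeSet \ {s(a, b)} := by
    rw [← edgeSet_deleteEdges]
    exact fun h => hxy (Adj.reachable h)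
  rw [edgeSet_sup, edgeSet_deleteEdges, edgeSet_edge_of_ne hne, Set.union_singleton,
    Set.ncard_insert_of_notMem hnot, Set.ncard_sdiff_singleton_add_one (T.mem_edgeSet.mpr hab)]
  lia

/-- Cycle property of a maximum-weight spanning tree: deleting an edge `s(a, b)` does not
disconnect the endpoints of a strictly heavier pair. -/
lemma IsTree.reachable_deleteEdges_of_weight_lt [Finite V] {w : Sym2 V → ℝ} (hT : T.IsTree)
    (hmax : ∀ T' : SimpleGraph V, T'.IsTree →
      ∑ e ∈ T'.edgeSet.toFinite.toFinset, w e ≤ ∑ e ∈ T.edgeSet.toFinite.toFinset, w e)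
    (hab : T.Adj a b) (hw : w s(a, b) < w s(x, y)) :
    (T.deleteEdges {s(a, b)}).Reachable x y := by
  classical
  by_contra hxy
  have hne : x ≠ y := fun h => hxy (h ▸ Reachable.refl x)
  have hle := hmax _ (hT.deleteEdges_sup_edge hab hxy)
  have hnot : s(x, y) ∉ T.edgeSet.toFinite.toFinset.erase s(a, b) := by
    intro h
    refine hxy (Adj.reachable ?_)
    simpa [deleteEdges_adj, and_comm] using h
  have heq : (T.deleteEdges {s(a, b)} ⊔ edge x y).edgeSet.toFinite.toFinset =
      insert s(x, y) (T.edgeSet.toFinite.toFinset.erase s(a, b)) := by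
    ext f
    simp only [Set.Finite.mem_toFinset, edgeSet_sup, edgeSet_deleteEdges,
      edgeSet_edge_of_ne hne, Set.mem_union, Set.mem_sdiff, Set.mem_singleton_iff,
      Finset.mem_insert, Finset.mem_erase]
    tauto
  have hmem : s(a, b) ∈ T.edgeSet.toFinite.toFinset := by simpa using hab
  rw [heq, Finset.sum_insert hnot, ← Finset.add_sum_erase _ _ hmem] at hle
  linarith

/-- A set with at least two points, any two of them joined by a walk in `G`, and which no edge
of `G` leaves, contains an edge of `G`. -/
lemma exists_mem_edgeSet_forall_mem {S : Set V} (hS : S.Nontrivial)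
    (hreach : ∀ x ∈ S, ∀ y ∈ S, G.Reachable x y)
    (hclosed : ∀ x ∈ S, ∀ y, G.Adj x y → y ∈ S) :
    ∃ f ∈ G.edgeSet, ∀ v ∈ f, v ∈ S := by
  obtain ⟨x, hx, y, hy, hne⟩ := hS
  obtain ⟨p⟩ := hreach x hx y hy
  have hadj := p.adj_snd (p.not_nil_of_ne hne)
  refine ⟨s(x, p.snd), hadj, fun v hv => ?_⟩
  rcases Sym2.mem_iff.mp hv with rfl | rfl
  exacts [hx, hclosed _ hx _ hadj]

/-- A component's support is `S` as soon as it meets `S`, `S` lies in one component, and no edge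
leaves `S`. -/
lemma supp_connectedComponentMk_eq {S : Set V} (ha : a ∈ S)
    (hreach : ∀ x ∈ S, ∀ y ∈ S, G.Reachable x y)
    (hclosed : ∀ x ∈ S, ∀ y, G.Adj x y → y ∈ S) :
    (G.connectedComponentMk a).supp = S := by
  ext v
  rw [ConnectedComponent.mem_supp_iff, ConnectedComponent.eq]
  refine ⟨fun ⟨p⟩ => ?_, fun hv => hreach v hv a ha⟩
  by_contra hv
  obtain ⟨d, -, hd, hd'⟩ := p.reverse.exists_boundary_dart S ha hv
  exact hd' (hclosed _ hd _ d.adj)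

end SimpleGraph

/-- If every value of `f` on `s` is below every value on `t`, the same holds for averages. -/
lemma Finset.sum_div_card_lt_sum_div_card {ι : Type*} {s t : Finset ι} {f : ι → ℝ}
    (hs : s.Nonempty) (ht : t.Nonempty) (h : ∀ x ∈ s, ∀ y ∈ t, f x < f y) :
    (∑ x ∈ s, f x) / (#s : ℝ) < (∑ y ∈ t, f y) / (#t : ℝ) := by
  obtain ⟨m, hm, hmax⟩ := s.exists_max_image f hs
  have hs' : (0 : ℝ) < #s := by exact_mod_cast hs.card_pos
  have ht' : (0 : ℝ) < #t := by exact_mod_cast ht.card_pos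
  calc (∑ x ∈ s, f x) / (#s : ℝ) ≤ f m := by
        rw [div_le_iff₀ hs', mul_comm, ← nsmul_eq_mul]
        exact Finset.sum_le_card_nsmul _ _ _ hmax
    _ < (∑ y ∈ t, f y) / (#t : ℝ) := by
        rw [lt_div_iff₀ ht', mul_comm, ← nsmul_eq_mul, ← Finset.sum_const]
        exact Finset.sum_lt_sum_of_nonempty ht (h m hm)

/-- **correctness of MST-AD.** Let `T` be a maximum-weight spanning tree
of the weighted complete graph on the client set `C` (here the whole finite type `V`),
with attacker set `M` and the separation inequality holding.  Then:
(i) `T` contains exactly one cross edge `e` (one endpoint in `M`, the other in `C \ M`);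
(ii) `e` is the unique minimum-weight edge of `T` (every other edge of `T` has strictly
greater weight);
(iii) deleting `e` from `T` yields exactly two connected components whose vertex sets
are exactly `M` and `C \ M`; and
(iv) the average edge weight of the component on `M` is strictly greater than that of
the component on `C \ M`.
Hence the MST-AD procedure (build a maximum spanning tree, delete its lowest-weight
edge, output the sub-tree of higher average edge weight) returns exactly `M`. -/
theorem mstAD_returns_attackers {V : Type*} [Fintype V] [DecidableEq V]
    (w : Sym2 V → ℝ) (M : Finset V)
    (hM : 2 ≤ M.card) (hN : 2 ≤ Mᶜ.card)
    (hsep : ∀ p ∈ M, ∀ q ∈ M, p ≠ q → ∀ i ∈ Mᶜ, ∀ j ∈ Mᶜ, i ≠ j →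
      ∀ p' ∈ M, ∀ i' ∈ Mᶜ, w s(i', p') < w s(i, j) ∧ w s(i, j) < w s(p, q))
    (T : SimpleGraph V) (hT : T.IsTree)
    (hmax : ∀ T' : SimpleGraph V, T'.IsTree →
      ∑ e ∈ T'.edgeSet.toFinite.toFinset, w e ≤ ∑ e ∈ T.edgeSet.toFinite.toFinset, w e) :
    ∃ e ∈ T.edgeSet,
      -- (i) e is a cross edge, and it is the only one
      (∃ a b, a ∈ M ∧ b ∉ M ∧ e = s(a, b)) ∧
      (∀ f ∈ T.edgeSet, (∃ a b, a ∈ M ∧ b ∉ M ∧ f = s(a, b)) → f = e) ∧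
      -- (ii) e is the unique minimum-weight edge of T
      (∀ f ∈ T.edgeSet, f ≠ e → w e < w f) ∧
      -- (iii) deleting e yields exactly two components, on M and on C \ M
      (∃ c₁ c₂ : (T.deleteEdges {e}).ConnectedComponent,
        c₁ ≠ c₂ ∧ (∀ c : (T.deleteEdges {e}).ConnectedComponent, c = c₁ ∨ c = c₂) ∧
        c₁.supp = (↑M : Set V) ∧ c₂.supp = (↑(Mᶜ) : Set V)) ∧
      -- (iv) the component on M has strictly greater average edge weight
      (∑ f ∈ ({f ∈ (T.deleteEdges {e}).edgeSet | ∀ v ∈ f, v ∈ M}).toFinite.toFinset, w f) /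
          (({f ∈ (T.deleteEdges {e}).edgeSet | ∀ v ∈ f, v ∈ M}).toFinite.toFinset.card : ℝ) >
        (∑ f ∈ ({f ∈ (T.deleteEdges {e}).edgeSet | ∀ v ∈ f, v ∉ M}).toFinite.toFinset, w f) /
          (({f ∈ (T.deleteEdges {e}).edgeSet | ∀ v ∈ f, v ∉ M}).toFinite.toFinset.card : ℝ) := by
  have hMnt : (M : Set V).Nontrivial := Finset.one_lt_card_iff_nontrivial.mp hM
  have hNnt : (↑(Mᶜ) : Set V).Nontrivial := Finset.one_lt_card_iff_nontrivial.mp hN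
  obtain ⟨p₀, hp₀, q₀, hq₀, hpq⟩ := id hMnt
  obtain ⟨i₀, hi₀, j₀, hj₀, hij⟩ := id hNnt
  have hcross : ∀ a ∈ M, ∀ b ∈ Mᶜ, ∀ i ∈ Mᶜ, ∀ j ∈ Mᶜ, i ≠ j → w s(a, b) < w s(i, j) :=
    fun a ha b hb i hi j hj h =>
      Sym2.eq_swap (a := a) (b := b) ▸ (hsep p₀ hp₀ q₀ hq₀ hpq i hi j hj h a ha b hb).1
  have hinner : ∀ p ∈ M, ∀ q ∈ M, p ≠ q → ∀ i ∈ Mᶜ, ∀ j ∈ Mᶜ, i ≠ j → w s(i, j) < w s(p, q) :=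
    fun p hp q hq h i hi j hj h' => (hsep p hp q hq h i hi j hj h' p₀ hp₀ i₀ hi₀).2
  have hcrossM : ∀ a ∈ M, ∀ b ∈ Mᶜ, ∀ p ∈ M, ∀ q ∈ M, p ≠ q → w s(a, b) < w s(p, q) :=
    fun a ha b hb p hp q hq h => (hcross a ha b hb i₀ hi₀ j₀ hj₀ hij).trans
      (hinner p hp q hq h i₀ hi₀ j₀ hj₀ hij)
  obtain ⟨a, b, ha, hb, hab⟩ : ∃ a b, a ∈ M ∧ b ∈ Mᶜ ∧ T.Adj a b := by
    obtain ⟨p⟩ := hT.connected.preconnected p₀ i₀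
    obtain ⟨d, -, hd, hd'⟩ := p.exists_boundary_dart (M : Set V) hp₀ (by simpa using hi₀)
    exact ⟨d.fst, d.snd, hd, by simpa using hd', d.adj⟩
  set G := T.deleteEdges {s(a, b)}
  have hreachM : ∀ x ∈ (M : Set V), ∀ y ∈ (M : Set V), G.Reachable x y := by
    intro x hx y hy
    rcases eq_or_ne x y with rfl | hne
    · rfl
    · exact hT.reachable_deleteEdges_of_weight_lt hmax hab (hcrossM a ha b hb x hx y hy hne)
  have hreachN : ∀ x ∈ (↑(Mᶜ) : Set V), ∀ y ∈ (↑(Mᶜ) : Set V), G.Reachable x y := by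
    intro x hx y hy
    rcases eq_or_ne x y with rfl | hne
    · rfl
    · exact hT.reachable_deleteEdges_of_weight_lt hmax hab (hcross a ha b hb x hx y hy hne)
  have hbridge : ¬ G.Reachable a b :=
    isBridge_iff.mp (isAcyclic_iff_forall_adj_isBridge.mp hT.isAcyclic hab)
  have hnoadj : ∀ x ∈ M, ∀ y ∈ Mᶜ, ¬ G.Adj x y := fun x hx y hy h =>
    hbridge ((hreachM a ha x hx).trans (h.reachable.trans (hreachN y hy b hb)))
  have hclosedM : ∀ x ∈ (M : Set V), ∀ y, G.Adj x y → y ∈ (M : Set V) := fun x hx y h => by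
    by_contra hy
    exact hnoadj x hx y (by simpa using hy) h
  have hclosedN : ∀ x ∈ (↑(Mᶜ) : Set V), ∀ y, G.Adj x y → y ∈ (↑(Mᶜ) : Set V) :=
    fun x hx y h => by
      by_contra hy
      exact hnoadj y (by simpa using hy) x hx h.symm
  refine ⟨s(a, b), hab, ⟨a, b, ha, by simpa using hb, rfl⟩, ?_, ?_, ?_, ?_⟩
  · rintro _ hf ⟨x, y, hx, hy, rfl⟩
    by_contra hne
    exact hnoadj x hx y (by simpa using hy) (deleteEdges_adj.mpr ⟨hf, hne⟩)
  · intro f hf hne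
    induction f with
    | _ x y =>
      have hadj : G.Adj x y := deleteEdges_adj.mpr ⟨hf, hne⟩
      by_cases hx : x ∈ M
      · exact hcrossM a ha b hb x hx y (hclosedM x hx y hadj) hadj.ne
      · have hx' : x ∈ Mᶜ := by simpa using hx
        exact hcross a ha b hb x hx' y (hclosedN x hx' y hadj) hadj.ne
  · refine ⟨G.connectedComponentMk a, G.connectedComponentMk b,
      fun h => hbridge (ConnectedComponent.exact h), fun c => ?_,
      supp_connectedComponentMk_eq ha hreachM hclosedM,
      supp_connectedComponentMk_eq hb hreachN hclosedN⟩
    induction c using ConnectedComponent.ind with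
    | _ v =>
      by_cases hv : v ∈ M
      · exact Or.inl (ConnectedComponent.sound (hreachM v hv a ha))
      · exact Or.inr (ConnectedComponent.sound (hreachN v (by simpa using hv) b hb))
  · obtain ⟨f, hf, hfM⟩ := exists_mem_edgeSet_forall_mem hMnt hreachM hclosedM
    obtain ⟨g, hg, hgN⟩ := exists_mem_edgeSet_forall_mem hNnt hreachN hclosedN
    refine Finset.sum_div_card_lt_sum_div_card
      ⟨g, (Set.Finite.mem_toFinset _).mpr ⟨hg, fun v hv => by simpa using hgN v hv⟩⟩
      ⟨f, (Set.Finite.mem_toFinset _).mpr ⟨hf, hfM⟩⟩ fun x hx y hy => ?_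
    rw [Set.Finite.mem_toFinset] at hx hy
    obtain ⟨hx, hxN⟩ := hx
    obtain ⟨hy, hyM⟩ := hy
    induction x with
    | _ i j =>
      induction y with
      | _ p q =>
        exact hinner p (hyM p (by simp)) q (hyM q (by simp)) (G.ne_of_adj hy)
          i (by simpa using hxN i (by simp)) j (by simpa using hxN j (by simp)) (G.ne_of_adj hx)
end

section
/- Every maximum-weight spanning tree T of the weighted complete graph on C contains exactly one cross edge, i.e., exactly one edge with one endpoint in M and the other endpoint in C\M. -/
open Finset SimpleGraph

/-- In a connected graph, some edge leaves any set that is neither empty nor everything. -/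
theorem SimpleGraph.Preconnected.exists_adj_mem_notMem {V : Type*} {G : SimpleGraph V}
    (hG : G.Preconnected) {M : Finset V} {u v : V} (hu : u ∈ M) (hv : v ∉ M) :
    ∃ a ∈ M, ∃ b ∉ M, G.Adj a b := by
  obtain ⟨p⟩ := hG u v
  obtain ⟨d, -, h₁, h₂⟩ := p.exists_boundary_dart (M : Set V) (by simpa using hu)
    (by simpa using hv)
  exact ⟨d.fst, by simpa using h₁, d.snd, by simpa using h₂, d.adj⟩

/-- Replacing an edge of a finite tree by an edge between the two resulting components
gives a tree. -/
theorem SimpleGraph.IsTree.deleteEdges_sup_edge_s1 {V : Type*} [Finite V] {T : SimpleGraph V}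
    (hT : T.IsTree) {a b x y : V} (hab : T.Adj a b)
    (hxy : ¬(T.deleteEdges {s(a, b)}).Reachable x y) :
    (T.deleteEdges {s(a, b)} ⊔ edge x y).IsTree := by
  have hacyc : (T.deleteEdges {s(a, b)} ⊔ edge x y).IsAcyclic :=
    (hT.isAcyclic.anti (T.deleteEdges_le _)).sup_edge_of_not_reachable hxy
  have := hT.connected.nonempty
  obtain ⟨F, hle, -, hF⟩ := connected_top.exists_isTree_le_of_le_of_isAcyclic le_top hacyc
  have hne : x ≠ y := by rintro rfl; exact hxy .rfl
  have hnotMem : s(x, y) ∉ T.edgeSet \ {s(a, b)} := by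
    rw [← edgeSet_deleteEdges]
    exact fun h => hxy (Adj.reachable h)
  have hcard : (T.deleteEdges {s(a, b)} ⊔ edge x y).edgeSet.ncard = F.edgeSet.ncard := by
    have hTc := (isTree_iff_connected_and_card.1 hT).2
    have hFc := (isTree_iff_connected_and_card.1 hF).2
    rw [Nat.card_coe_set_eq] at hTc hFc
    rw [edgeSet_sup, edgeSet_deleteEdges, edgeSet_edge_of_ne hne,
      Set.union_singleton,
      Set.ncard_insert_of_notMem hnotMem (Set.toFinite _),
      Set.ncard_sdiff_singleton_add_one (show s(a, b) ∈ T.edgeSet from hab) (Set.toFinite _)]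
    lia
  have heq := Set.eq_of_subset_of_ncard_le (edgeSet_subset_edgeSet.2 hle) hcard.ge (Set.toFinite _)
  rwa [edgeSet_inj.1 heq]

/-- An edge of a maximum-weight spanning tree is at least as heavy as every edge joining the
two components left by its deletion. -/
theorem SimpleGraph.IsTree.weight_le_of_not_reachable_deleteEdges {V : Type*} [Finite V]
    {T : SimpleGraph V} (hT : T.IsTree) (w : Sym2 V → ℝ)
    (hmax : ∀ T' : SimpleGraph V, T'.IsTree →
      ∑ e ∈ T'.edgeSet.toFinite.toFinset, w e ≤ ∑ e ∈ T.edgeSet.toFinite.toFinset, w e)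
    {a b x y : V} (hab : T.Adj a b) (hxy : ¬(T.deleteEdges {s(a, b)}).Reachable x y) :
    w s(x, y) ≤ w s(a, b) := by
  classical
  have hne : x ≠ y := by rintro rfl; exact hxy .rfl
  have hle := hmax _ (hT.deleteEdges_sup_edge_s1 hab hxy)
  have hmem : s(a, b) ∈ T.edgeSet.toFinite.toFinset := by simpa using hab
  have hnotMem : s(x, y) ∉ T.edgeSet.toFinite.toFinset.erase s(a, b) := by
    intro h
    apply hxy
    apply Adj.reachable
    rw [← mem_edgeSet, edgeSet_deleteEdges]
    simpa [and_comm] using h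
  have heq : (T.deleteEdges {s(a, b)} ⊔ edge x y).edgeSet.toFinite.toFinset =
      insert s(x, y) (T.edgeSet.toFinite.toFinset.erase s(a, b)) := by
    ext e
    rw [Set.Finite.mem_toFinset, edgeSet_sup, edgeSet_deleteEdges,
      edgeSet_edge_of_ne hne]
    simp only [Set.mem_union, Set.mem_sdiff, Set.mem_singleton_iff, Finset.mem_insert,
      Finset.mem_erase, Set.Finite.mem_toFinset]
    tauto
  rw [heq, Finset.sum_insert hnotMem] at hle
  linarith [Finset.add_sum_erase _ w hmem]

/-- Every maximum-weight spanning tree `T` of the weighted complete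
graph on the client set `V` (with attacker set `M`, the separation inequality holding)
contains exactly one cross edge, i.e. exactly one edge with one endpoint in `M` and
the other endpoint in `C \ M`. -/
theorem mst_unique_cross_edge {V : Type*} [Fintype V] [DecidableEq V]
    (w : Sym2 V → ℝ) (M : Finset V)
    (hM : 2 ≤ M.card) (hN : 2 ≤ Mᶜ.card)
    (hsep : ∀ p ∈ M, ∀ q ∈ M, p ≠ q → ∀ i ∈ Mᶜ, ∀ j ∈ Mᶜ, i ≠ j →
      ∀ p' ∈ M, ∀ i' ∈ Mᶜ, w s(i', p') < w s(i, j) ∧ w s(i, j) < w s(p, q))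
    (T : SimpleGraph V) (hT : T.IsTree)
    (hmax : ∀ T' : SimpleGraph V, T'.IsTree →
      ∑ e ∈ T'.edgeSet.toFinite.toFinset, w e ≤ ∑ e ∈ T.edgeSet.toFinite.toFinset, w e) :
    ∃! e : Sym2 V, e ∈ T.edgeSet ∧ ∃ a b, a ∈ M ∧ b ∉ M ∧ e = s(a, b) := by
  obtain ⟨i, hi, j, hj, hij⟩ := Finset.one_lt_card.1 hN
  obtain ⟨p, hp, q, hq, hpq⟩ := Finset.one_lt_card.1 hM
  obtain ⟨x, hx, y, hy, hxy⟩ :=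
    hT.connected.preconnected.exists_adj_mem_notMem hp (Finset.mem_compl.1 hi)
  refine ⟨s(x, y), ⟨hxy, x, y, hx, hy, rfl⟩, ?_⟩
  rintro _ ⟨hcd, c, d, hc, hd, rfl⟩
  by_contra hne
  have hnab : ¬(T.deleteEdges {s(x, y)}).Reachable x y :=
    isBridge_iff.1 (isAcyclic_iff_forall_adj_isBridge.1 hT.isAcyclic hxy)
  have hcd' : (T.deleteEdges {s(x, y)}).Adj c d := by
    simpa [deleteEdges_adj] using ⟨hcd, by simpa using hne⟩
  have hM_reach : ∀ m ∈ M, (T.deleteEdges {s(x, y)}).Reachable m x := by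
    intro m hm
    by_contra hmx
    have hle := hT.weight_le_of_not_reachable_deleteEdges w hmax hxy hmx
    have hmx' : m ≠ x := by rintro rfl; exact hmx .rfl
    have h := hsep m hm x hx hmx' i hi j hj hij x hx y (Finset.mem_compl.2 hy)
    rw [Sym2.eq_swap (a := y)] at h
    linarith
  have hN_reach : ∀ n ∉ M, (T.deleteEdges {s(x, y)}).Reachable n y := by
    intro n hn
    by_contra hny
    have hle := hT.weight_le_of_not_reachable_deleteEdges w hmax hxy hny
    have hny' : n ≠ y := by rintro rfl; exact hny .rfl
    have h := hsep p hp q hq hpq n (Finset.mem_compl.2 hn) y (Finset.mem_compl.2 hy) hny'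
      x hx y (Finset.mem_compl.2 hy)
    rw [Sym2.eq_swap (a := y)] at h
    linarith
  exact hnab ((hM_reach c hc).symm.trans (hcd'.reachable.trans (hN_reach d hd)))
end

section
/- Every maximum-weight spanning tree T of the weighted complete graph on C has exactly |M| − 1 edges with both endpoints in M, exactly |C\M| − 1 edges with both endpoints in C\M, and exactly 1 edge between M and C\M; in particular, the subgraphs of T induced on M and on C\M are each connected (they are spanning trees of M and of C\M, respectively). -/
open Finset SimpleGraph

/-- Adding an edge `s(u, v)` to a tree and deleting an edge of the walk from `u` to `v` gives a
tree again. -/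
theorem SimpleGraph.IsTree.exchange {V : Type*} [Finite V] {T : SimpleGraph V} (hT : T.IsTree)
    {u v : V} (huv : u ≠ v) (hadj : ¬ T.Adj u v) {p : T.Walk u v} (hp : p.IsPath)
    {e : Sym2 V} (he : e ∈ p.edges) :
    ((T ⊔ edge u v).deleteEdges {e}).IsTree ∧
      ((T ⊔ edge u v).deleteEdges {e}).edgeSet = insert s(u, v) (T.edgeSet \ {e}) := by
  have heT : e ∈ T.edgeSet := p.edges_subset_edgeSet he
  have hne : e ≠ s(u, v) := by rintro rfl; exact hadj heT
  have hset : ((T ⊔ edge u v).deleteEdges {e}).edgeSet = insert s(u, v) (T.edgeSet \ {e}) := by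
    rw [edgeSet_deleteEdges, edgeSet_sup, edgeSet_edge_of_ne huv]
    grind
  have hle : T ≤ T ⊔ edge u v := le_sup_left
  have hvu : (T ⊔ edge u v).Adj v u := by simp [edge_adj, huv, huv.symm]
  have hcycle : (Walk.cons hvu (p.mapLe hle)).IsCycle := by
    refine Path.cons_isCycle ⟨p.mapLe hle, hp.mapLe hle⟩ hvu ?_
    intro h
    simp only [Walk.edges_mapLe_eq_edges] at h
    exact hadj (p.edges_subset_edgeSet h).symm
  have hbridge : ¬ (T ⊔ edge u v).IsBridge e := fun h ↦
    h.notMem_edges_of_isCycle hcycle (by simp [he])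
  have hconn : ((T ⊔ edge u v).deleteEdges {e}).Connected := by
    induction e with
    | h a b => exact (hT.connected.mono hle).connected_delete_edge_of_not_isBridge hbridge
  refine ⟨isTree_iff_connected_and_card.mpr ⟨hconn, ?_⟩, hset⟩
  have hcard := (isTree_iff_connected_and_card.mp hT).2
  rw [Nat.card_coe_set_eq] at hcard ⊢
  rw [hset, Set.ncard_insert_of_notMem (by simp [hadj]), Set.ncard_sdiff_singleton_add_one heT,
    hcard]

/-- If every edge leaving `S` is lighter than every edge inside `S`, then a maximum-weight
spanning tree induces a tree on `S`. -/
theorem SimpleGraph.IsTree.induce_of_isMax {V : Type*} [Finite V]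
    {w : Sym2 V → ℝ} {T : SimpleGraph V} (hT : T.IsTree)
    (hmax : ∀ T' : SimpleGraph V, T'.IsTree →
      ∑ e ∈ T'.edgeSet.toFinite.toFinset, w e ≤ ∑ e ∈ T.edgeSet.toFinite.toFinset, w e)
    {S : Set V} (hS : S.Nonempty)
    (hw : ∀ a ∈ S, ∀ b ∉ S, ∀ u ∈ S, ∀ v ∈ S, u ≠ v → w s(a, b) < w s(u, v)) :
    (T.induce S).IsTree := by
  classical
  have := hS.to_subtype
  refine ⟨⟨?_⟩, hT.isAcyclic.induce S⟩
  rintro ⟨u, hu⟩ ⟨v, hv⟩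
  by_contra hnr
  obtain ⟨p, hp, -⟩ := hT.existsUnique_path u v
  have huv : u ≠ v := by rintro rfl; exact hnr .rfl
  have hadj : ¬ T.Adj u v := fun h ↦ hnr (Adj.reachable (by simpa using h))
  have hleave : ∃ x ∈ p.support, x ∉ S := by
    by_contra! h
    exact hnr (p.induce S h).reachable
  obtain ⟨x, hx, hxS⟩ := hleave
  obtain ⟨d, hd, hd1, hd2⟩ := (p.takeUntil x hx).exists_boundary_dart S hu hxS
  have he : s(d.fst, d.snd) ∈ p.edges :=
    p.edges_takeUntil_subset_edges hx (List.mem_map.mpr ⟨d, hd, rfl⟩)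
  have heT := p.edges_subset_edgeSet he
  obtain ⟨htree, hset⟩ := hT.exchange huv hadj hp he
  have hle := hmax _ htree
  have hfin : ((T ⊔ edge u v).deleteEdges {s(d.fst, d.snd)}).edgeSet.toFinite.toFinset =
      insert s(u, v) (T.edgeSet.toFinite.toFinset.erase s(d.fst, d.snd)) := by
    ext f
    simp only [Set.Finite.mem_toFinset, hset, Finset.mem_insert, Finset.mem_erase,
      Set.mem_insert_iff, Set.mem_sdiff, Set.mem_singleton_iff]
    tauto
  rw [hfin, Finset.sum_insert (by simp [hadj]),
    ← Finset.add_sum_erase T.edgeSet.toFinite.toFinset w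
      (T.edgeSet.toFinite.mem_toFinset.mpr heT)] at hle
  linarith [hw _ hd1 _ hd2 u hu v hv huv]

/-- The edges of the induced graph on `S` correspond to the edges with both endpoints in `S`. -/
theorem SimpleGraph.ncard_edgeSet_induce {V : Type*} (G : SimpleGraph V) (S : Set V) :
    (G.induce S).edgeSet.ncard = {f ∈ G.edgeSet | ∀ v ∈ f, v ∈ S}.ncard := by
  have himage : {f ∈ G.edgeSet | ∀ v ∈ f, v ∈ S} =
      Sym2.map (Subtype.val : S → V) '' (G.induce S).edgeSet := by
    ext f
    constructor
    · induction f with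
      | h a b =>
        rintro ⟨hf, h⟩
        exact ⟨s(⟨a, h a (by simp)⟩, ⟨b, h b (by simp)⟩), by simpa using hf, rfl⟩
    · rintro ⟨g, hg, rfl⟩
      induction g with
      | h a b => exact ⟨by simpa using hg, by simp⟩
  rw [himage, Set.ncard_image_of_injective _ (Sym2.map.injective Subtype.val_injective)]

/-- Every maximum-weight spanning tree `T` of the weighted complete
graph on the client set has exactly `|M| - 1` edges with both endpoints in the attacker
set `M`, exactly `|C \ M| - 1` edges with both endpoints in `C \ M`, and exactly one
edge between `M` and `C \ M`; in particular the subgraphs of `T` induced on `M` and on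
`C \ M` are each connected (they are spanning trees of `M` and of `C \ M`, resp.). -/
theorem mst_edge_counts {V : Type*} [Fintype V] [DecidableEq V]
    (w : Sym2 V → ℝ) (M : Finset V)
    (hM : 2 ≤ M.card) (hN : 2 ≤ Mᶜ.card)
    (hsep : ∀ p ∈ M, ∀ q ∈ M, p ≠ q → ∀ i ∈ Mᶜ, ∀ j ∈ Mᶜ, i ≠ j →
      ∀ p' ∈ M, ∀ i' ∈ Mᶜ, w s(i', p') < w s(i, j) ∧ w s(i, j) < w s(p, q))
    (T : SimpleGraph V) (hT : T.IsTree)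
    (hmax : ∀ T' : SimpleGraph V, T'.IsTree →
      ∑ e ∈ T'.edgeSet.toFinite.toFinset, w e ≤ ∑ e ∈ T.edgeSet.toFinite.toFinset, w e) :
    ({f ∈ T.edgeSet | ∀ v ∈ f, v ∈ M}).toFinite.toFinset.card = M.card - 1 ∧
    ({f ∈ T.edgeSet | ∀ v ∈ f, v ∉ M}).toFinite.toFinset.card = Mᶜ.card - 1 ∧
    ({f ∈ T.edgeSet | ∃ a b, a ∈ M ∧ b ∉ M ∧ f = s(a, b)}).toFinite.toFinset.card = 1 ∧
    (T.induce (↑M : Set V)).IsTree ∧ (T.induce (↑(Mᶜ) : Set V)).IsTree := by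
  obtain ⟨p, hp, q, hq, hpq⟩ := Finset.one_lt_card.mp hM
  obtain ⟨i, hi, j, hj, hij⟩ := Finset.one_lt_card.mp hN
  have htM : (T.induce (↑M : Set V)).IsTree := by
    refine hT.induce_of_isMax hmax ⟨p, hp⟩ fun a ha b hb u hu v hv huv ↦ ?_
    rw [Sym2.eq_swap]
    obtain ⟨h₁, h₂⟩ := hsep u hu v hv huv i hi j hj hij a ha b (by simpa using hb)
    exact h₁.trans h₂
  have htN : (T.induce (↑(Mᶜ) : Set V)).IsTree := by
    refine hT.induce_of_isMax hmax ⟨i, hi⟩ fun a ha b hb u hu v hv huv ↦ ?_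
    exact (hsep p hp q hq hpq u hu v hv huv b (by simpa using hb) a ha).1
  have hcM := (isTree_iff_connected_and_card.mp htM).2
  have hcN := (isTree_iff_connected_and_card.mp htN).2
  have hcT := (isTree_iff_connected_and_card.mp hT).2
  rw [Nat.card_coe_set_eq, Nat.card_coe_set_eq, Set.ncard_coe_finset,
    ncard_edgeSet_induce] at hcM hcN
  rw [Nat.card_coe_set_eq, Nat.card_eq_fintype_card, ← Finset.card_add_card_compl M] at hcT
  simp only [Finset.mem_coe, Finset.mem_compl] at hcM hcN
  have hsplit : T.edgeSet = ({f ∈ T.edgeSet | ∀ v ∈ f, v ∈ M} ∪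
      {f ∈ T.edgeSet | ∀ v ∈ f, v ∉ M}) ∪
      {f ∈ T.edgeSet | ∃ a b, a ∈ M ∧ b ∉ M ∧ f = s(a, b)} := by
    refine Set.Subset.antisymm (fun f hf ↦ ?_)
      (Set.union_subset (Set.union_subset (Set.sep_subset _ _) (Set.sep_subset _ _))
        (Set.sep_subset _ _))
    induction f with
    | h a b =>
      by_cases ha : a ∈ M <;> by_cases hb : b ∈ M
      · exact .inl (.inl ⟨hf, by simp [ha, hb]⟩)
      · exact .inr ⟨hf, a, b, ha, hb, rfl⟩
      · exact .inr ⟨hf, b, a, hb, ha, Sym2.eq_swap⟩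
      · exact .inl (.inr ⟨hf, by simp [ha, hb]⟩)
  have hdisj : Disjoint {f ∈ T.edgeSet | ∀ v ∈ f, v ∈ M} {f ∈ T.edgeSet | ∀ v ∈ f, v ∉ M} := by
    refine Set.disjoint_left.mpr fun f h h' ↦ ?_
    induction f with
    | h a b => exact h'.2 a (by simp) (h.2 a (by simp))
  have hdisj' : Disjoint ({f ∈ T.edgeSet | ∀ v ∈ f, v ∈ M} ∪ {f ∈ T.edgeSet | ∀ v ∈ f, v ∉ M})
      {f ∈ T.edgeSet | ∃ a b, a ∈ M ∧ b ∉ M ∧ f = s(a, b)} := by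
    refine Set.disjoint_left.mpr ?_
    rintro _ (h | h) ⟨-, a, b, ha, hb, rfl⟩
    · exact hb (h.2 b (by simp))
    · exact h.2 a (by simp) ha
  rw [hsplit, Set.ncard_union_eq hdisj', Set.ncard_union_eq hdisj] at hcT
  simp only [← Set.ncard_eq_toFinset_card]
  exact ⟨by omega, by omega, by omega, htM, htN⟩
end

section
/- Among all subsets of C of size |M|, the attacker set M is the unique maximizer of density: for every S ⊆ C with |S| = |M| and S ≠ M, one has density(S) < density(M). -/
open Finset

/-- The density of a finite vertex subset `S`: the average of the weight `w` over all
unordered pairs of distinct elements of `S`, i.e. the sum of `w` over such pairs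
divided by `|S| choose 2`. -/
noncomputable def density {V : Type*} [DecidableEq V] (w : Sym2 V → ℝ) (S : Finset V) : ℝ :=
  (∑ e ∈ S.sym2.filter (fun e => ¬ e.IsDiag), w e) / (S.card.choose 2 : ℕ)

/-- The non-diagonal pairs of `S` are counted by `S.card.choose 2`. -/
lemma card_sym2_filter_not_isDiag {V : Type*} [DecidableEq V] (S : Finset V) :
    (S.sym2.filter (fun e => ¬ e.IsDiag)).card = S.card.choose 2 := by
  rw [← Sym2.card_image_offDiag]
  congr 1
  ext e
  induction e using Sym2.ind with
  | _ a b =>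
    simp only [mem_filter, mk_mem_sym2_iff, Sym2.mk_isDiag_iff, mem_image, mem_offDiag, Prod.exists]
    constructor
    · rintro ⟨⟨ha, hb⟩, hab⟩
      exact ⟨a, b, ⟨ha, hb, hab⟩, rfl⟩
    · rintro ⟨x, y, ⟨hx, hy, hxy⟩, h⟩
      rcases Sym2.eq_iff.1 h with ⟨rfl, rfl⟩ | ⟨rfl, rfl⟩
      · exact ⟨⟨hx, hy⟩, hxy⟩
      · exact ⟨⟨hy, hx⟩, fun h => hxy h.symm⟩

/-- If every value of `f` off `t` is smaller than every value of `f` on `t`, then `t` has the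
strictly largest sum among the finsets of its cardinality. -/
lemma sum_lt_sum_of_card_eq_of_forall_lt {α : Type*} [DecidableEq α] (f : α → ℝ) {s t : Finset α}
    (hcard : s.card = t.card) (hne : (s \ t).Nonempty)
    (hlt : ∀ a ∈ s \ t, ∀ b ∈ t, f a < f b) :
    ∑ a ∈ s, f a < ∑ b ∈ t, f b := by
  have hcard' : (s \ t).card = (t \ s).card := card_sdiff_comm hcard
  have hne' : (t \ s).Nonempty := by
    rw [← card_pos, ← hcard']
    exact hne.card_pos
  obtain ⟨b, hb, hmin⟩ := exists_min_image (t \ s) f hne'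
  have h₁ : ∑ a ∈ s \ t, f a < ∑ _a ∈ s \ t, f b :=
    sum_lt_sum_of_nonempty hne fun a ha => hlt a ha b (mem_sdiff.1 hb).1
  have h₂ : ∑ _a ∈ t \ s, f b ≤ ∑ a ∈ t \ s, f a := sum_le_sum hmin
  simp only [sum_const, hcard'] at h₁ h₂
  have hs := sum_inter_add_sum_sdiff s t f
  have ht := sum_inter_add_sum_sdiff t s f
  rw [inter_comm] at ht
  linarith

/-- Among all subsets of the client set of size `|M|`, the attacker set
`M` is the unique maximizer of density: every `S ⊆ C` with `|S| = |M|` and `S ≠ M`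
satisfies `density S < density M`. -/
theorem attacker_set_unique_densest {V : Type*} [Fintype V] [DecidableEq V]
    (w : Sym2 V → ℝ) (M : Finset V)
    (hM : 2 ≤ M.card) (hN : 2 ≤ Mᶜ.card)
    (hsep : ∀ p ∈ M, ∀ q ∈ M, p ≠ q → ∀ i ∈ Mᶜ, ∀ j ∈ Mᶜ, i ≠ j →
      ∀ p' ∈ M, ∀ i' ∈ Mᶜ, w s(i', p') < w s(i, j) ∧ w s(i, j) < w s(p, q)) :
    ∀ S : Finset V, S.card = M.card → S ≠ M → density w S < density w M := by
  intro S hS hne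
  have hpos : (0 : ℝ) < (M.card.choose 2 : ℕ) := by
    exact_mod_cast Nat.choose_pos hM
  unfold density
  rw [hS]
  refine div_lt_div_of_pos_right (sum_lt_sum_of_card_eq_of_forall_lt w ?_ ?_ ?_) hpos
  · rw [card_sym2_filter_not_isDiag, card_sym2_filter_not_isDiag, hS]
  · obtain ⟨x, hxS, hxM⟩ : ∃ x ∈ S, x ∉ M :=
      not_subset.1 fun h => hne (eq_of_subset_of_card_le h hS.ge)
    obtain ⟨y, hyS, hyx⟩ := exists_mem_ne (by omega : 1 < S.card) x
    exact ⟨s(x, y), by simp [hxS, hyS, hxM, hyx.symm]⟩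
  · obtain ⟨k, hk, l, hl, hkl⟩ := one_lt_card.1 hN
    intro e he f hf
    induction e using Sym2.ind with
    | _ a b =>
    induction f using Sym2.ind with
    | _ p q =>
      simp only [mem_sdiff, mem_filter, mk_mem_sym2_iff, Sym2.mk_isDiag_iff] at he hf
      obtain ⟨⟨-, hab⟩, hnot⟩ := he
      obtain ⟨⟨hp, hq⟩, hpq⟩ := hf
      have cross : ∀ m ∈ M, ∀ i ∈ Mᶜ, w s(i, m) < w s(p, q) := fun m hm i hi =>
        have h := hsep p hp q hq hpq k hk l hl hkl m hm i hi
        h.1.trans h.2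
      by_cases ha : a ∈ M <;> by_cases hb : b ∈ M
      · exact absurd ⟨⟨ha, hb⟩, hab⟩ hnot
      · rw [Sym2.eq_swap]
        exact cross a ha b (mem_compl.2 hb)
      · exact cross b hb a (mem_compl.2 ha)
      · exact (hsep p hp q hq hpq a (mem_compl.2 ha) b (mem_compl.2 hb) hab p hp k hk).2
end

section
/- Adding any normal clients to the attacker set strictly decreases its density: for every S ⊆ C with M ⊊ S (i.e., S strictly contains M), one has density(S) < density(M). Equivalently, every vertex of S \ M is a sparse vertex relative to the attacker core: removing all of S\M from S strictly increases the density. -/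
open Finset

/-- Enlarging a nonempty finite set by elements whose values are all below the values on the
original set strictly lowers the average. -/
theorem average_lt_average_of_subset {α : Type*} [DecidableEq α] (f : α → ℝ) {A B : Finset α}
    (hAB : A ⊂ B) (hA : A.Nonempty) (h : ∀ b ∈ B \ A, ∀ a ∈ A, f b < f a) :
    (∑ e ∈ B, f e) / #B < (∑ e ∈ A, f e) / #A := by
  have hApos : (0 : ℝ) < #A := by exact_mod_cast hA.card_pos
  have hBpos : (0 : ℝ) < #B := by exact_mod_cast (hA.mono hAB.subset).card_pos
  have hlt : ∀ b ∈ B \ A, f b < (∑ e ∈ A, f e) / #A := by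
    intro b hb
    rw [lt_div_iff₀ hApos]
    have := sum_lt_sum_of_nonempty hA (h b hb)
    rw [sum_const, nsmul_eq_mul] at this
    linarith
  have hsum := sum_lt_sum_of_nonempty (sdiff_nonempty.mpr hAB.not_subset) hlt
  rw [sum_const, nsmul_eq_mul] at hsum
  have hsplit := sum_sdiff (f := f) hAB.subset
  have hcard : (#(B \ A) : ℝ) + #A = #B := by
    exact_mod_cast card_sdiff_add_card_eq_card hAB.subset
  rw [div_lt_iff₀ hBpos, ← hsplit, ← hcard, mul_add, div_mul_cancel₀ _ hApos.ne']
  linarith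

/-- A finite set has `|S| choose 2` unordered pairs of distinct elements. -/
theorem card_filter_sym2_not_isDiag {V : Type*} [DecidableEq V] (S : Finset V) :
    #(S.sym2.filter fun e => ¬ e.IsDiag) = (#S).choose 2 := by
  rw [← Sym2.card_image_offDiag, sym2_eq_image, Sym2.filter_image_mk_not_isDiag]

/-- Adding any normal clients to the attacker set strictly decreases
its density: for every `S ⊆ C` strictly containing `M` one has
`density S < density M`; equivalently, removing all of `S \ M` from `S` strictly
increases the density. -/
theorem adding_normals_decreases_density {V : Type*} [Fintype V] [DecidableEq V]
    (w : Sym2 V → ℝ) (M : Finset V)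
    (hM : 2 ≤ M.card) (hN : 2 ≤ Mᶜ.card)
    (hsep : ∀ p ∈ M, ∀ q ∈ M, p ≠ q → ∀ i ∈ Mᶜ, ∀ j ∈ Mᶜ, i ≠ j →
      ∀ p' ∈ M, ∀ i' ∈ Mᶜ, w s(i', p') < w s(i, j) ∧ w s(i, j) < w s(p, q)) :
    ∀ S : Finset V, M ⊂ S → density w S < density w M := by
  intro S hMS
  obtain ⟨p, hp, q, hq, hpq⟩ := one_lt_card.mp hM
  obtain ⟨i, hi, j, hj, hij⟩ := one_lt_card.mp hN
  obtain ⟨x, hxS, hxM⟩ := exists_of_ssubset hMS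
  unfold density
  rw [← card_filter_sym2_not_isDiag S, ← card_filter_sym2_not_isDiag M]
  apply average_lt_average_of_subset
  · rw [ssubset_iff_of_subset (filter_subset_filter _ (sym2_mono hMS.subset))]
    refine ⟨s(x, p), ?_, ?_⟩
    · simp only [mem_filter, mk_mem_sym2_iff, Sym2.mk_isDiag_iff]
      exact ⟨⟨hxS, hMS.subset hp⟩, fun h => hxM (h ▸ hp)⟩
    · simp [hxM]
  · exact ⟨s(p, q), by simp [hp, hq, hpq]⟩
  · intro b hb a ha
    induction a with | _ c d
    induction b with | _ u v
    simp only [mem_sdiff, mem_filter, mk_mem_sym2_iff, Sym2.mk_isDiag_iff] at ha hb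
    obtain ⟨⟨hc, hd⟩, hcd⟩ := ha
    obtain ⟨⟨-, huv⟩, hbM⟩ := hb
    by_cases hu : u ∈ M <;> by_cases hv : v ∈ M
    · exact absurd ⟨⟨hu, hv⟩, huv⟩ hbM
    · obtain ⟨h₁, h₂⟩ := hsep c hc d hd hcd i hi j hj hij u hu v (mem_compl.mpr hv)
      rw [Sym2.eq_swap]
      exact h₁.trans h₂
    · obtain ⟨h₁, h₂⟩ := hsep c hc d hd hcd i hi j hj hij v hv u (mem_compl.mpr hu)
      exact h₁.trans h₂
    · exact (hsep c hc d hd hcd u (mem_compl.mpr hu) v (mem_compl.mpr hv) huv p hp i hi).2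
end

section
/- Exchange lemma: for any attacker a ∈ M and any normal client n ∈ C\M, the total pair weight strictly decreases when a is replaced by n, i.e., Σ_{\{x,y\} ⊆ (M\{a\})∪\{n\}} w(x, y) < Σ_{\{x,y\} ⊆ M} w(x, y). More generally, for any A ⊆ M and any N ⊆ C\M with |N| = |A| ≥ 1, the set S = (M \ A) ∪ N satisfies Σ_{\{x,y\} ⊆ S} w(x, y) < Σ_{\{x,y\} ⊆ M} w(x, y). -/
open Finset

/-- The total pair weight of a finite vertex subset `S`: the sum of the weight `w`
over all unordered pairs of distinct elements of `S`. -/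
noncomputable def pairSum {V : Type*} [DecidableEq V] (w : Sym2 V → ℝ) (S : Finset V) : ℝ :=
  ∑ e ∈ S.sym2.filter (fun e => ¬ e.IsDiag), w e

lemma pairSum_image {V : Type*} [DecidableEq V] (w : Sym2 V → ℝ) {f : V → V} {S : Finset V}
    (hf : Set.InjOn f S) : pairSum w (S.image f) = pairSum (fun e => w (e.map f)) S := by
  symm
  unfold pairSum
  refine Finset.sum_bij (fun e _ => e.map f) ?_ ?_ ?_ (fun _ _ => rfl)
  · intro e
    induction e with | _ x y =>
    simp only [mem_filter, mk_mem_sym2_iff, Sym2.mk_isDiag_iff, Sym2.map_mk]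
    rintro ⟨⟨hx, hy⟩, hxy⟩
    exact ⟨⟨mem_image_of_mem f hx, mem_image_of_mem f hy⟩, fun h => hxy (hf hx hy h)⟩
  · intro e he e' he'
    induction e with | _ x y =>
    induction e' with | _ x' y' =>
    simp only [mem_filter, mk_mem_sym2_iff] at he he'
    obtain ⟨⟨hx, hy⟩, -⟩ := he
    obtain ⟨⟨hx', hy'⟩, -⟩ := he'
    simp only [Sym2.map_mk, Sym2.eq_iff]
    rintro (⟨h, h'⟩ | ⟨h, h'⟩)
    · exact Or.inl ⟨hf hx hx' h, hf hy hy' h'⟩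
    · exact Or.inr ⟨hf hx hy' h, hf hy hx' h'⟩
  · intro e
    induction e with | _ x y =>
    simp only [mem_filter, mk_mem_sym2_iff, Sym2.mk_isDiag_iff, mem_image]
    rintro ⟨⟨⟨x, hx, rfl⟩, ⟨y, hy, rfl⟩⟩, hxy⟩
    refine ⟨s(x, y), ?_, rfl⟩
    simp only [mk_mem_sym2_iff, Sym2.mk_isDiag_iff]
    exact ⟨⟨hx, hy⟩, fun h => hxy (congrArg f h)⟩

lemma pairSum_lt_pairSum {V : Type*} [DecidableEq V] {v w : Sym2 V → ℝ} {S : Finset V}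
    (hle : ∀ x ∈ S, ∀ y ∈ S, x ≠ y → v s(x, y) ≤ w s(x, y))
    (hlt : ∃ x ∈ S, ∃ y ∈ S, x ≠ y ∧ v s(x, y) < w s(x, y)) :
    pairSum v S < pairSum w S := by
  refine Finset.sum_lt_sum ?_ ?_
  · intro e
    induction e with | _ x y =>
    simp only [mem_filter, mk_mem_sym2_iff, Sym2.mk_isDiag_iff]
    rintro ⟨⟨hx, hy⟩, hxy⟩
    exact hle x hx y hy hxy
  · obtain ⟨x, hx, y, hy, hxy, h⟩ := hlt
    refine ⟨s(x, y), ?_, h⟩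
    simp only [mem_filter, mk_mem_sym2_iff, Sym2.mk_isDiag_iff]
    exact ⟨⟨hx, hy⟩, hxy⟩

lemma exists_injOn_image_sdiff_union {V : Type*} [DecidableEq V] {M A N : Finset V}
    (hA : A ⊆ M) (hMN : Disjoint M N) (hcard : N.card = A.card) :
    ∃ f : V → V, Set.InjOn f M ∧ M.image f = (M \ A) ∪ N ∧
      (∀ x ∈ A, f x ∈ N) ∧ ∀ x ∉ A, f x = x := by
  let e := Finset.equivOfCardEq hcard.symm
  let f : V → V := fun x => if h : x ∈ A then (e ⟨x, h⟩ : V) else x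
  have hfA : ∀ x (h : x ∈ A), f x = e ⟨x, h⟩ := fun x h => dif_pos h
  have hfN : ∀ x ∈ A, f x ∈ N := fun x h => hfA x h ▸ (e ⟨x, h⟩).2
  have hf : ∀ x ∉ A, f x = x := fun x h => dif_neg h
  have hd : ∀ x ∈ M, x ∉ N := fun x hx hn => Finset.disjoint_left.mp hMN hx hn
  refine ⟨f, ?_, ?_, hfN, hf⟩
  · intro x hx y hy h
    by_cases hxA : x ∈ A <;> by_cases hyA : y ∈ A
    · rw [hfA x hxA, hfA y hyA] at h
      simpa using e.injective (Subtype.ext h)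
    · exact absurd (hf y hyA ▸ h ▸ hfN x hxA) (hd y hy)
    · exact absurd (hf x hxA ▸ h ▸ hfN y hyA) (hd x hx)
    · rwa [hf x hxA, hf y hyA] at h
  · ext z
    simp only [mem_image, mem_union, mem_sdiff]
    constructor
    · rintro ⟨x, hx, rfl⟩
      by_cases hxA : x ∈ A
      · exact Or.inr (hfN x hxA)
      · rw [hf x hxA]
        exact Or.inl ⟨hx, hxA⟩
    · rintro (⟨hz, hzA⟩ | hz)
      · exact ⟨z, hz, hf z hzA⟩
      · refine ⟨e.symm ⟨z, hz⟩, hA (e.symm ⟨z, hz⟩).2, ?_⟩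
        rw [hfA _ (e.symm ⟨z, hz⟩).2]
        simp

/-- **exchange lemma.** For any attacker `a ∈ M` and normal client
`n ∈ C \ M`, replacing `a` by `n` strictly decreases the total pair weight; more
generally, for any `A ⊆ M` and `N ⊆ C \ M` with `|N| = |A| ≥ 1`, the set
`S = (M \ A) ∪ N` has strictly smaller total pair weight than `M`. -/
theorem exchange_lemma {V : Type*} [Fintype V] [DecidableEq V]
    (w : Sym2 V → ℝ) (M : Finset V)
    (hM : 2 ≤ M.card) (hN : 2 ≤ Mᶜ.card)
    (hsep : ∀ p ∈ M, ∀ q ∈ M, p ≠ q → ∀ i ∈ Mᶜ, ∀ j ∈ Mᶜ, i ≠ j →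
      ∀ p' ∈ M, ∀ i' ∈ Mᶜ, w s(i', p') < w s(i, j) ∧ w s(i, j) < w s(p, q)) :
    (∀ a ∈ M, ∀ n ∈ Mᶜ, pairSum w (insert n (M.erase a)) < pairSum w M) ∧
    (∀ A : Finset V, A ⊆ M → ∀ N : Finset V, N ⊆ Mᶜ → N.card = A.card → 1 ≤ A.card →
      pairSum w ((M \ A) ∪ N) < pairSum w M) := by
  have general : ∀ A : Finset V, A ⊆ M → ∀ N : Finset V, N ⊆ Mᶜ → N.card = A.card →
      1 ≤ A.card → pairSum w ((M \ A) ∪ N) < pairSum w M := by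
    intro A hA N hNM hcard hpos
    have hdisj : Disjoint M N := disjoint_compl_right.mono_right hNM
    obtain ⟨f, hinj, himg, hfA, hf⟩ := exists_injOn_image_sdiff_union hA hdisj hcard
    rw [← himg, pairSum_image w hinj]
    obtain ⟨i, hi, j, hj, hij⟩ := Finset.one_lt_card.mp hN
    have hlt : ∀ x ∈ A, ∀ y ∈ M, x ≠ y → w s(f x, f y) < w s(x, y) := by
      intro x hx y hy hxy
      by_cases hyA : y ∈ A
      · exact (hsep x (hA hx) y hy hxy _ (hNM (hfA x hx)) _ (hNM (hfA y hyA))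
          (fun h => hxy (hinj (hA hx) hy h)) y hy i hi).2
      · rw [hf y hyA]
        obtain ⟨h₁, h₂⟩ := hsep x (hA hx) y hy hxy i hi j hj hij y hy _ (hNM (hfA x hx))
        exact h₁.trans h₂
    refine pairSum_lt_pairSum ?_ ?_
    · intro x hx y hy hxy
      rw [Sym2.map_mk]
      by_cases hxA : x ∈ A
      · exact (hlt x hxA y hy hxy).le
      by_cases hyA : y ∈ A
      · rw [Sym2.eq_swap, Sym2.eq_swap (a := x)]
        exact (hlt y hyA x hx hxy.symm).le
      · rw [hf x hxA, hf y hyA]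
    · obtain ⟨a, ha⟩ := Finset.card_pos.mp hpos
      obtain ⟨b, hb, hba⟩ := Finset.exists_mem_ne hM a
      exact ⟨a, hA ha, b, hb, hba.symm, hlt a ha b hb hba.symm⟩
  refine ⟨fun a ha n hn => ?_, general⟩
  have h := general {a} (singleton_subset_iff.mpr ha) {n} (singleton_subset_iff.mpr hn)
    (by simp) (by simp)
  rwa [sdiff_singleton_eq_erase, union_comm, ← insert_eq] at h
end

section
/- Cut separation lemma: let C be a finite set, S ⊆ C with 1 ≤ |S| and 1 ≤ |C\S|, and let w be a symmetric real weight on unordered pairs of distinct elements of C such that every cross pair (one endpoint in S, one in C\S) has strictly smaller weight than every non-cross pair (both endpoints in S or both in C\S). Then every maximum-weight spanning tree of the complete graph on C contains exactly one cross edge. -/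
open Finset SimpleGraph

namespace SimpleGraph

variable {V : Type*} {G : SimpleGraph V} {a b x y : V}

/-- Deleting an edge from a connected graph leaves every vertex reachable from one of its ends. -/
lemma Connected.reachable_deleteEdges_or (hG : G.Connected) (a b v : V) :
    (G.deleteEdges {s(a, b)}).Reachable a v ∨ (G.deleteEdges {s(a, b)}).Reachable b v := by
  obtain ⟨c, hc, ⟨p⟩⟩ : ∃ c, a = c ∧ G.Reachable v c := ⟨a, rfl, hG v a⟩
  induction p with
  | nil => exact .inl (hc ▸ .rfl)
  | @cons u v _ h p ih =>
    by_cases he : s(u, v) = s(a, b)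
    · rcases Sym2.eq_iff.mp he with ⟨rfl, -⟩ | ⟨rfl, -⟩
      · exact .inl .rfl
      · exact .inr .rfl
    · have huv : (G.deleteEdges {s(a, b)}).Adj v u := by
        rw [deleteEdges_adj]
        exact ⟨h.symm, by rwa [Set.mem_singleton_iff, Sym2.eq_swap]⟩
      exact (ih hc).imp (·.trans huv.reachable) (·.trans huv.reachable)

/-- Replacing an edge of a tree by an edge joining the two resulting components gives a tree. -/
lemma IsTree.deleteEdges_sup_edge_s10 (hG : G.IsTree) (hab : G.Adj a b)
    (hx : (G.deleteEdges {s(a, b)}).Reachable a x)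
    (hy : (G.deleteEdges {s(a, b)}).Reachable b y) :
    (G.deleteEdges {s(a, b)} ⊔ edge x y).IsTree := by
  have hbridge : ¬ (G.deleteEdges {s(a, b)}).Reachable a b :=
    isAcyclic_iff_forall_isBridge.mp hG.isAcyclic (G.mem_edgeSet.mpr hab)
  have hxy : ¬ (G.deleteEdges {s(a, b)}).Reachable x y := fun h =>
    hbridge ((hx.trans h).trans hy.symm)
  have hne : x ≠ y := fun h => hxy (h ▸ .rfl)
  have hadj : (G.deleteEdges {s(a, b)} ⊔ edge x y).Adj x y := by simp [hne, edge_adj]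
  have hle : G.deleteEdges {s(a, b)} ≤ G.deleteEdges {s(a, b)} ⊔ edge x y := le_sup_left
  refine ⟨(connected_iff_exists_forall_reachable _).mpr ⟨a, fun v => ?_⟩,
    (hG.isAcyclic.anti (deleteEdges_le _)).sup_edge_of_not_reachable hxy⟩
  rcases hG.connected.reachable_deleteEdges_or a b v with h | h
  · exact h.mono hle
  · exact ((hx.mono hle).trans hadj.reachable).trans ((hy.symm.trans h).mono hle)

/-- In a maximum-weight spanning tree, an edge is at least as heavy as any edge that could
replace it. -/
lemma IsTree.weight_le_of_isMax [Finite V] {w : Sym2 V → ℝ} (hG : G.IsTree)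
    (hmax : ∀ T : SimpleGraph V, T.IsTree →
      ∑ e ∈ T.edgeSet.toFinite.toFinset, w e ≤ ∑ e ∈ G.edgeSet.toFinite.toFinset, w e)
    (hab : G.Adj a b) (hx : (G.deleteEdges {s(a, b)}).Reachable a x)
    (hy : (G.deleteEdges {s(a, b)}).Reachable b y) : w s(x, y) ≤ w s(a, b) := by
  classical
  have hbridge : ¬ (G.deleteEdges {s(a, b)}).Reachable a b :=
    isAcyclic_iff_forall_isBridge.mp hG.isAcyclic (G.mem_edgeSet.mpr hab)
  have hxy : ¬ (G.deleteEdges {s(a, b)}).Reachable x y := fun h =>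
    hbridge ((hx.trans h).trans hy.symm)
  have hne : x ≠ y := fun h => hxy (h ▸ .rfl)
  have hnot : s(x, y) ∉ G.edgeSet.toFinite.toFinset.erase s(a, b) := fun h => by
    refine hxy (Adj.reachable ?_)
    simpa [and_comm] using h
  have hedges : (G.deleteEdges {s(a, b)} ⊔ edge x y).edgeSet.toFinite.toFinset =
      insert s(x, y) (G.edgeSet.toFinite.toFinset.erase s(a, b)) := by
    ext e
    simp only [Set.Finite.mem_toFinset, edgeSet_sup, edgeSet_deleteEdges, edgeSet_edge_of_ne hne,
      Set.mem_union, Set.mem_sdiff, Set.mem_singleton_iff, mem_insert, mem_erase]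
    tauto
  have hle := hmax _ (hG.deleteEdges_sup_edge_s10 hab hx hy)
  have hmem : s(a, b) ∈ G.edgeSet.toFinite.toFinset := by simpa using hab
  rw [hedges, sum_insert hnot, ← add_sum_erase _ _ hmem] at hle
  linarith

end SimpleGraph

/-- **cut separation lemma.** Let `C` be a finite vertex set, `S ⊆ C`
with `1 ≤ |S|` and `1 ≤ |C \ S|`, and let `w` be a weight on unordered pairs such that
every cross pair (one endpoint in `S`, one in `C \ S`) has strictly smaller weight than
every non-cross pair (both endpoints in `S` or both in `C \ S`).  Then every
maximum-weight spanning tree of the complete graph on `C` contains exactly one cross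
edge. -/
theorem cut_separation_unique_cross_edge {V : Type*} [Fintype V] [DecidableEq V]
    (w : Sym2 V → ℝ) (S : Finset V)
    (hS : 1 ≤ S.card) (hSc : 1 ≤ Sᶜ.card)
    (hsep : ∀ a ∈ S, ∀ b ∈ Sᶜ, ∀ x y : V, x ≠ y →
      ((x ∈ S ∧ y ∈ S) ∨ (x ∉ S ∧ y ∉ S)) → w s(a, b) < w s(x, y)) :
    ∀ T : SimpleGraph V, T.IsTree →
      (∀ T' : SimpleGraph V, T'.IsTree →
        ∑ e ∈ T'.edgeSet.toFinite.toFinset, w e ≤ ∑ e ∈ T.edgeSet.toFinite.toFinset, w e) →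
      ∃! e : Sym2 V, e ∈ T.edgeSet ∧ ∃ a b, a ∈ S ∧ b ∉ S ∧ e = s(a, b) := by
  intro T hT hmax
  obtain ⟨s, hs⟩ := card_pos.mp hS
  obtain ⟨t, ht⟩ := card_pos.mp hSc
  obtain ⟨p⟩ := hT.connected s t
  obtain ⟨⟨⟨a, b⟩, hab⟩, -, ha, hb⟩ :=
    p.exists_boundary_dart (S : Set V) hs (by simpa using ht)
  replace ha : a ∈ S := by simpa using ha
  replace hb : b ∉ S := by simpa using hb
  refine ⟨s(a, b), ⟨hab, a, b, ha, hb, rfl⟩, ?_⟩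
  rintro _ ⟨hcd, c, d, hc, hd, rfl⟩
  by_contra hne
  have hadj : (T.deleteEdges {s(a, b)}).Adj c d := by
    rw [deleteEdges_adj]
    exact ⟨hcd, hne⟩
  have hbridge : ¬ (T.deleteEdges {s(a, b)}).Reachable a b :=
    isAcyclic_iff_forall_isBridge.mp hT.isAcyclic (T.mem_edgeSet.mpr hab)
  rcases hT.connected.reachable_deleteEdges_or a b c with h | h
  · have had := h.trans hadj.reachable
    exact (hsep a ha b (by simpa using hb) d b (fun h => hbridge (h ▸ had))
      (.inr ⟨hd, hb⟩)).not_ge (hT.weight_le_of_isMax hmax hab had .rfl)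
  · exact (hsep a ha b (by simpa using hb) a c (by rintro rfl; exact hbridge h.symm)
      (.inl ⟨ha, hc⟩)).not_ge (hT.weight_le_of_isMax hmax hab .rfl h)
end
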